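/- arXiv:1701.03430 — 8 statements merged into one kernel-verified Lean document; each statement's English description precedes it below -/
import Mathlib

section
/- Let G be a digraph on n > 1 nodes that is (r,s)-robust with r ≥ 1 and s ≥ 1 and r,s < n, and suppose s+1 < n. Then G is (r−1, s+1)-robust. -/
open Finset

/-- In-neighbor set of node `i` in the digraph with edge set `E`:
`(j, i) ∈ E` means node `i` receives information from node `j`. -/
def inNbr {n : ℕ} (E : Finset (Fin n × Fin n)) (i : Fin n) : Finset (Fin n) :=
  Finset.univ.filter fun j => (j, i) ∈ E

/-- `XSet E r S` is the set of nodes of `S` having at least `r` in-neighbors outside `S`. -/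
def XSet {n : ℕ} (E : Finset (Fin n × Fin n)) (r : ℕ) (S : Finset (Fin n)) :
    Finset (Fin n) :=
  S.filter fun i => r ≤ ((inNbr E i) \ S).card

/-- The digraph with edge set `E` is `(r,s)`-robust. -/
def IsRSRobust {n : ℕ} (E : Finset (Fin n × Fin n)) (r s : ℕ) : Prop :=
  ∀ S1 S2 : Finset (Fin n), S1.Nonempty → S2.Nonempty → Disjoint S1 S2 →
    XSet E r S1 = S1 ∨ XSet E r S2 = S2 ∨
      s ≤ (XSet E r S1).card + (XSet E r S2).card

theorem XSet_subset {n : ℕ} (E : Finset (Fin n × Fin n)) (r : ℕ) (S : Finset (Fin n)) :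
    XSet E r S ⊆ S :=
  filter_subset _ _

theorem XSet_anti {n : ℕ} (E : Finset (Fin n × Fin n)) {r r' : ℕ} (h : r ≤ r')
    (S : Finset (Fin n)) : XSet E r' S ⊆ XSet E r S := by
  intro i hi
  simp only [XSet, mem_filter] at hi ⊢
  exact ⟨hi.1, h.trans hi.2⟩

/-- Deleting a node from `S` raises the number of in-neighbors outside `S` by at most one. -/
theorem XSet_erase_subset {n : ℕ} (E : Finset (Fin n × Fin n)) (r : ℕ) (S : Finset (Fin n))
    (x : Fin n) : XSet E r (S.erase x) ⊆ (XSet E (r - 1) S).erase x := by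
  intro i hi
  simp only [XSet, mem_filter, mem_erase] at hi ⊢
  have hsub : inNbr E i \ S.erase x ⊆ insert x (inNbr E i \ S) := by
    intro j hj
    simp only [mem_sdiff, mem_erase, mem_insert] at hj ⊢
    tauto
  have hcard := (card_le_card hsub).trans (card_insert_le _ _)
  exact ⟨hi.1.1, hi.1.2, by omega⟩

theorem XSet_ne_self_of_pred {n : ℕ} {E : Finset (Fin n × Fin n)} {r : ℕ} {S : Finset (Fin n)}
    (h : XSet E (r - 1) S ≠ S) : XSet E r S ≠ S := fun h' =>
  h ((XSet_subset E _ S).antisymm (h'.symm.subset.trans (XSet_anti E (Nat.sub_le r 1) S)))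

/-- If an `(r,s)`-robust digraph had a pair violating `(r-1,s+1)`-robustness, then deleting a
node of `XSet E (r - 1) S1` from `S1` would violate `(r,s)`-robustness. -/
theorem IsRSRobust.lt_card_add_card {n : ℕ} {E : Finset (Fin n × Fin n)} {r s : ℕ}
    (hrob : IsRSRobust E r s) {S1 S2 : Finset (Fin n)} (hS2 : S2.Nonempty)
    (hd : Disjoint S1 S2) (h1 : XSet E (r - 1) S1 ≠ S1) (h2 : XSet E (r - 1) S2 ≠ S2)
    (hX : (XSet E (r - 1) S1).Nonempty) :
    s < (XSet E (r - 1) S1).card + (XSet E (r - 1) S2).card := by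
  obtain ⟨x, hx⟩ := hX
  obtain ⟨y, hyS, hyX⟩ := exists_of_ssubset ((XSet_subset E (r - 1) S1).ssubset_of_ne h1)
  have hy : y ∈ S1.erase x := mem_erase.2 ⟨fun h => hyX (h ▸ hx), hyS⟩
  have hsub := XSet_erase_subset E r S1 x
  have hlt := (card_le_card hsub).trans_lt (card_erase_lt_of_mem hx)
  have hle := card_le_card (XSet_anti E (Nat.sub_le r 1) S2)
  rcases hrob (S1.erase x) S2 ⟨y, hy⟩ hS2 (hd.mono_left (erase_subset _ _)) with h | h | h
  · exact absurd (mem_of_mem_erase (hsub (h.symm ▸ hy))) hyX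
  · exact absurd h (XSet_ne_self_of_pred h2)
  · omega

/-- if `G` is `(r,s)`-robust with `r ≥ 1`, `s ≥ 1`, `r,s < n` and `s+1 < n`,
then `G` is `(r-1, s+1)`-robust. -/
theorem robust_trade {n : ℕ} (hn : 1 < n) (E : Finset (Fin n × Fin n)) (r s : ℕ)
    (hr1 : 1 ≤ r) (hs1 : 1 ≤ s) (hrn : r < n) (hsn : s < n) (hsn1 : s + 1 < n)
    (hrob : IsRSRobust E r s) :
    IsRSRobust E (r - 1) (s + 1) := by
  intro S1 S2 hS1 hS2 hd
  by_contra! hcon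
  obtain ⟨h1, h2, hlt⟩ := hcon
  have hle1 := card_le_card (XSet_anti E (Nat.sub_le r 1) S1)
  have hle2 := card_le_card (XSet_anti E (Nat.sub_le r 1) S2)
  rcases hrob S1 S2 hS1 hS2 hd with h | h | h
  · exact XSet_ne_self_of_pred h1 h
  · exact XSet_ne_self_of_pred h2 h
  · rcases (XSet E (r - 1) S1).eq_empty_or_nonempty with hX | hX
    · have hX2 : (XSet E (r - 1) S2).Nonempty := by
        rw [hX, card_empty] at hle1
        exact card_pos.1 (by omega)
      have := hrob.lt_card_add_card hS1 hd.symm h2 h1 hX2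
      omega
    · have := hrob.lt_card_add_card hS2 hd h1 h2 hX
      omega
end

section
/- Let G be a digraph on n > 1 nodes that is (r,s)-robust with r ≥ 1 and s ≥ 1. Then G has a directed spanning tree, i.e., there exists a node v ∈ V such that for every other node w ∈ V there is a directed path from v to w in G. -/
open Finset

/-- A set of nodes closed under taking in-neighbors has no node with an in-neighbor outside. -/
theorem XSet_eq_empty_of_inNbr_subset {n : ℕ} {E : Finset (Fin n × Fin n)} {r : ℕ}
    (hr : 1 ≤ r) {S : Finset (Fin n)} (hS : ∀ i ∈ S, inNbr E i ⊆ S) : XSet E r S = ∅ := by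
  refine Finset.filter_eq_empty_iff.2 fun i hi => ?_
  rw [Finset.sdiff_eq_empty_iff_subset.2 (hS i hi), Finset.card_empty]
  omega

/-- In a robust digraph, two nonempty sets closed under taking in-neighbors intersect. -/
theorem IsRSRobust.not_disjoint {n : ℕ} {E : Finset (Fin n × Fin n)} {r s : ℕ}
    (h : IsRSRobust E r s) (hr : 1 ≤ r) (hs : 1 ≤ s) {S T : Finset (Fin n)}
    (hS : S.Nonempty) (hT : T.Nonempty)
    (hSc : ∀ i ∈ S, inNbr E i ⊆ S) (hTc : ∀ i ∈ T, inNbr E i ⊆ T) : ¬ Disjoint S T := by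
  intro hd
  have key := h S T hS hT hd
  rw [XSet_eq_empty_of_inNbr_subset hr hSc, XSet_eq_empty_of_inNbr_subset hr hTc] at key
  rcases key with h | h | h
  · exact hS.ne_empty h.symm
  · exact hT.ne_empty h.symm
  · rw [Finset.card_empty] at h
    omega

open Classical in
/-- In a robust digraph, any two nodes are reachable from a common node. -/
theorem IsRSRobust.exists_common_ancestor {n : ℕ} {E : Finset (Fin n × Fin n)} {r s : ℕ}
    (h : IsRSRobust E r s) (hr : 1 ≤ r) (hs : 1 ≤ s) (a b : Fin n) :
    ∃ c, Relation.ReflTransGen (fun a b : Fin n => (a, b) ∈ E) c a ∧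
      Relation.ReflTransGen (fun a b : Fin n => (a, b) ∈ E) c b := by
  let anc (v : Fin n) : Finset (Fin n) :=
    Finset.univ.filter fun u => Relation.ReflTransGen (fun a b : Fin n => (a, b) ∈ E) u v
  have hne (v : Fin n) : (anc v).Nonempty := ⟨v, by simp [anc, Relation.ReflTransGen.refl]⟩
  have hcl (v : Fin n) : ∀ i ∈ anc v, inNbr E i ⊆ anc v := by
    intro i hi j hj
    simp only [anc, inNbr, Finset.mem_filter, Finset.mem_univ, true_and] at hi hj ⊢
    exact hi.head hj
  obtain ⟨c, hca, hcb⟩ :=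
    Finset.not_disjoint_iff.1 (h.not_disjoint hr hs (hne a) (hne b) (hcl a) (hcl b))
  exact ⟨c, (Finset.mem_filter.1 hca).2, (Finset.mem_filter.1 hcb).2⟩

/-- an `(r,s)`-robust digraph with `r ≥ 1`, `s ≥ 1` has a directed spanning
tree: there is a node `v` from which every node `w` is reachable along directed edges
(edge `(a,b) ∈ E` can be traversed from `a` to `b`). -/
theorem robust_has_spanning_tree {n : ℕ} (hn : 1 < n) (E : Finset (Fin n × Fin n))
    (r s : ℕ) (hr1 : 1 ≤ r) (hs1 : 1 ≤ s)
    (hrob : IsRSRobust E r s) :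
    ∃ v : Fin n, ∀ w : Fin n,
      Relation.ReflTransGen (fun a b : Fin n => (a, b) ∈ E) v w := by
  have : Nonempty (Fin n) := ⟨⟨0, by omega⟩⟩
  have hdir : Directed
      (Function.swap (Relation.ReflTransGen fun a b : Fin n => (a, b) ∈ E)) id :=
    fun a b => hrob.exists_common_ancestor hr1 hs1 a b
  have : IsTrans (Fin n)
      (Function.swap (Relation.ReflTransGen fun a b : Fin n => (a, b) ∈ E)) :=
    ⟨fun _ _ _ hab hbc => Relation.ReflTransGen.trans hbc hab⟩
  exact hdir.finite_le id
end

section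
/- Let G be a digraph on n > 1 nodes that is (r,s)-robust with r ≥ 0, s ≥ 1 and r,s < n. Then r ≤ ⌈n/2⌉. -/
open Finset

theorem XSet_eq_empty_of_card_compl_lt {n : ℕ} (E : Finset (Fin n × Fin n)) {r : ℕ}
    {S : Finset (Fin n)} (h : Sᶜ.card < r) : XSet E r S = ∅ := by
  refine Finset.filter_eq_empty_iff.mpr fun i _ => not_le.mpr (lt_of_le_of_lt ?_ h)
  refine Finset.card_le_card fun j hj => ?_
  exact Finset.mem_compl.mpr (Finset.mem_sdiff.mp hj).2

/-- if `G` on `n > 1` nodes is `(r,s)`-robust with `s ≥ 1` and `r,s < n`,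
then `r ≤ ⌈n/2⌉` (for natural `n`, `⌈n/2⌉ = (n+1)/2`). -/
theorem robust_r_le_half {n : ℕ} (hn : 1 < n) (E : Finset (Fin n × Fin n)) (r s : ℕ)
    (hs1 : 1 ≤ s) (hrn : r < n) (hsn : s < n)
    (hrob : IsRSRobust E r s) :
    r ≤ (n + 1) / 2 := by
  by_contra! hr
  obtain ⟨S, -, hS⟩ := Finset.exists_subset_card_eq
    (s := (Finset.univ : Finset (Fin n))) (n := n / 2) (by simp; omega)
  have hSc : Sᶜ.card = n - n / 2 := by simp [Finset.card_compl, hS]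
  have hne : S.Nonempty := Finset.card_pos.mp (by omega)
  have hnec : Sᶜ.Nonempty := Finset.card_pos.mp (by omega)
  have hX : XSet E r S = ∅ := XSet_eq_empty_of_card_compl_lt E (by omega)
  have hXc : XSet E r Sᶜ = ∅ := XSet_eq_empty_of_card_compl_lt E (by rw [compl_compl]; omega)
  rcases hrob S Sᶜ hne hnec disjoint_compl_right with h | h | h
  · exact hne.ne_empty (h.symm.trans hX)
  · exact hnec.ne_empty (h.symm.trans hXc)
  · simp only [hX, hXc, Finset.card_empty] at h
    omega
end

section
/- Let G be a digraph on n > 1 nodes, and let r ≥ 0 and s ≥ 1 with r+s−1 < n and r,s < n. If G is (r+s−1)-robust, then G is (r,s)-robust. -/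
open Finset

/-- Removing from `S` its nodes with at least `r` in-neighbors outside `S` leaves a set in which
every node has fewer than `r + k` in-neighbors outside, where `k` is the number of removed nodes. -/
theorem card_inNbr_sdiff_sdiff_XSet_lt {n : ℕ} (E : Finset (Fin n × Fin n)) (r : ℕ)
    (S : Finset (Fin n)) {i : Fin n} (hi : i ∈ S \ XSet E r S) :
    (inNbr E i \ (S \ XSet E r S)).card < r + (XSet E r S).card := by
  have hr : (inNbr E i \ S).card < r := by
    rw [mem_sdiff] at hi
    by_contra! h
    exact hi.2 (mem_filter.2 ⟨hi.1, h⟩)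
  have hsub : inNbr E i \ (S \ XSet E r S) ⊆ (inNbr E i \ S) ∪ XSet E r S := by
    intro j
    simp only [mem_sdiff, mem_union]
    tauto
  have := (card_le_card hsub).trans (card_union_le _ _)
  omega

/-- If fewer than `s` nodes of `S` have at least `r` in-neighbors outside `S`, then no node of the
remaining part of `S` has `r + s - 1` in-neighbors outside that part. -/
theorem XSet_sdiff_XSet_eq_empty {n : ℕ} (E : Finset (Fin n × Fin n)) {r s : ℕ}
    {S : Finset (Fin n)} (h : (XSet E r S).card < s) :
    XSet E (r + s - 1) (S \ XSet E r S) = ∅ := by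
  refine filter_eq_empty_iff.2 fun i hi => ?_
  have := card_inNbr_sdiff_sdiff_XSet_lt E r S hi
  omega

theorem sdiff_XSet_nonempty {n : ℕ} {E : Finset (Fin n × Fin n)} {r : ℕ}
    {S : Finset (Fin n)} (h : XSet E r S ≠ S) : (S \ XSet E r S).Nonempty :=
  sdiff_nonempty.2 fun hS => h ((filter_subset _ _).antisymm hS)

/-- a digraph on `n > 1` nodes that is `(r+s-1)`-robust (i.e.,
`(r+s-1,1)`-robust), with `s ≥ 1`, `r+s-1 < n` and `r,s < n`, is `(r,s)`-robust. -/
theorem robust_of_sum_robust {n : ℕ} (hn : 1 < n) (E : Finset (Fin n × Fin n))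
    (r s : ℕ) (hs1 : 1 ≤ s) (hrsn : r + s - 1 < n) (hrn : r < n) (hsn : s < n)
    (hrob : IsRSRobust E (r + s - 1) 1) :
    IsRSRobust E r s := by
  intro S1 S2 _ _ hdisj
  by_contra! ⟨h1, h2, h⟩
  have e1 := XSet_sdiff_XSet_eq_empty E (r := r) (s := s) (S := S1) (by omega)
  have e2 := XSet_sdiff_XSet_eq_empty E (r := r) (s := s) (S := S2) (by omega)
  have n1 := sdiff_XSet_nonempty h1
  have n2 := sdiff_XSet_nonempty h2
  rcases hrob _ _ n1 n2 (hdisj.mono sdiff_subset sdiff_subset) with h | h | h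
  · exact n1.ne_empty (h.symm.trans e1)
  · exact n2.ne_empty (h.symm.trans e2)
  · simp [e1, e2] at h
end

section
/- Let L^N[k] ∈ ℝ^{n_N×n} (with n = n_N + n_M) be a matrix of the form L^N[k] = D^N[k] − A^N[k] where, for each normal row i, the off-diagonal entries satisfy A^N[k]_{ij} ∈ {0} ∪ [γ,1) with γ > 0, A^N[k]_{ii} = 0, the diagonal entry of D^N[k] equals the i-th row sum of A^N[k], and this row sum is at most 1; let the same hold for L^N[k−1]. Suppose T > 0 and α > 0 satisfy 1 + T²/2 ≤ αT ≤ 2 − T²/2. Define R = I_n − αT·diag(I_{n_N},0), Φ_{1k} = R + I_n − (T²/2)[L^N[k]; 0] and Φ_{2k} = −R − (T²/2)[L^N[k−1]; 0]. Then each of the first n_N rows of the n×2n matrix [Φ_{1k} Φ_{2k}] is entrywise nonnegative and sums to one. -/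
open Matrix

/-- `diag(I_{n_N}, 0)`: the `n×n` diagonal matrix with ones on the first `n_N`
diagonal entries (normal agents) and zeros afterward. -/
noncomputable def diagN (nN nM : ℕ) : Matrix (Fin nN ⊕ Fin nM) (Fin nN ⊕ Fin nM) ℝ :=
  Matrix.fromBlocks 1 0 0 0

/-- `R = I_n − αT·diag(I_{n_N}, 0)`. -/
noncomputable def Rmat (nN nM : ℕ) (T α : ℝ) :
    Matrix (Fin nN ⊕ Fin nM) (Fin nN ⊕ Fin nM) ℝ :=
  1 - (α * T) • diagN nN nM

/-- `[L^N; 0]`: the `n×n` matrix whose first `n_N` rows are `L^N` and last `n_M` rows 0. -/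
noncomputable def LNfull {nN nM : ℕ} (LN : Matrix (Fin nN) (Fin nN ⊕ Fin nM) ℝ) :
    Matrix (Fin nN ⊕ Fin nM) (Fin nN ⊕ Fin nM) ℝ :=
  Matrix.fromRows LN 0

/-- `Φ_{1k} = R + I_n − (T²/2)[L^N[k]; 0]`. -/
noncomputable def Phi1 {nN nM : ℕ} (T α : ℝ)
    (LNk : Matrix (Fin nN) (Fin nN ⊕ Fin nM) ℝ) :
    Matrix (Fin nN ⊕ Fin nM) (Fin nN ⊕ Fin nM) ℝ :=
  Rmat nN nM T α + 1 - (T ^ 2 / 2) • LNfull LNk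

/-- `Φ_{2k} = −R − (T²/2)[L^N[k−1]; 0]`. -/
noncomputable def Phi2 {nN nM : ℕ} (T α : ℝ)
    (LNk1 : Matrix (Fin nN) (Fin nN ⊕ Fin nM) ℝ) :
    Matrix (Fin nN ⊕ Fin nM) (Fin nN ⊕ Fin nM) ℝ :=
  -Rmat nN nM T α - (T ^ 2 / 2) • LNfull LNk1

/-- `L^N = D^N − A^N` built from adjacency weights: off-diagonal entries of `A^N` lie in
`{0} ∪ [γ,1)`, the "diagonal" entry `A^N_{i,(inl i)}` is zero, each row of `A^N` sums to
at most 1, and the diagonal entry of `D^N` is the corresponding row sum of `A^N`. -/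
def IsLaplacianRows {nN nM : ℕ} (γ : ℝ)
    (LN : Matrix (Fin nN) (Fin nN ⊕ Fin nM) ℝ) : Prop :=
  ∃ AN : Matrix (Fin nN) (Fin nN ⊕ Fin nM) ℝ,
    (∀ i j, AN i j = 0 ∨ (γ ≤ AN i j ∧ AN i j < 1)) ∧
    (∀ i, AN i (Sum.inl i) = 0) ∧
    (∀ i, (∑ j, AN i j) ≤ 1) ∧
    (∀ i j, LN i j = (if j = Sum.inl i then ∑ j', AN i j' else 0) - AN i j)

theorem IsLaplacianRows.sum_row_eq_zero {nN nM : ℕ} {γ : ℝ}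
    {LN : Matrix (Fin nN) (Fin nN ⊕ Fin nM) ℝ} (h : IsLaplacianRows γ LN) (i : Fin nN) :
    ∑ j, LN i j = 0 := by
  obtain ⟨A, -, -, -, hL⟩ := h
  simp only [hL, Finset.sum_sub_distrib, Finset.sum_ite_eq', Finset.mem_univ, if_true, sub_self]

theorem IsLaplacianRows.diag_le_one {nN nM : ℕ} {γ : ℝ}
    {LN : Matrix (Fin nN) (Fin nN ⊕ Fin nM) ℝ} (h : IsLaplacianRows γ LN) (i : Fin nN) :
    LN i (Sum.inl i) ≤ 1 := by
  obtain ⟨A, -, hdiag, hsum, hL⟩ := h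
  simpa [hL, hdiag] using hsum i

theorem IsLaplacianRows.offDiag_nonpos {nN nM : ℕ} {γ : ℝ} (hγ : 0 < γ)
    {LN : Matrix (Fin nN) (Fin nN ⊕ Fin nM) ℝ} (h : IsLaplacianRows γ LN) {i : Fin nN}
    {j : Fin nN ⊕ Fin nM} (hj : j ≠ Sum.inl i) : LN i j ≤ 0 := by
  obtain ⟨A, hA, -, -, hL⟩ := h
  rw [hL, if_neg hj]
  rcases hA i j with h0 | h0 <;> linarith

theorem IsLaplacianRows.scalar_sub_nonneg {nN nM : ℕ} {γ c t : ℝ} (hγ : 0 < γ) (ht : 0 ≤ t)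
    (htc : t ≤ c) {LN : Matrix (Fin nN) (Fin nN ⊕ Fin nM) ℝ} (h : IsLaplacianRows γ LN)
    (i : Fin nN) (j : Fin nN ⊕ Fin nM) :
    0 ≤ (if j = Sum.inl i then c else 0) - t * LN i j := by
  split_ifs with hj
  · subst hj
    nlinarith [h.diag_le_one i]
  · nlinarith [h.offDiag_nonpos hγ hj]

theorem IsLaplacianRows.sum_scalar_sub {nN nM : ℕ} {γ : ℝ} (c t : ℝ)
    {LN : Matrix (Fin nN) (Fin nN ⊕ Fin nM) ℝ} (h : IsLaplacianRows γ LN) (i : Fin nN) :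
    ∑ j, ((if j = Sum.inl i then c else 0) - t * LN i j) = c := by
  simp only [Finset.sum_sub_distrib, Finset.sum_ite_eq', Finset.mem_univ, if_true,
    ← Finset.mul_sum, h.sum_row_eq_zero, mul_zero, sub_zero]

theorem Rmat_inl_apply {nN nM : ℕ} (T α : ℝ) (i : Fin nN) (j : Fin nN ⊕ Fin nM) :
    Rmat nN nM T α (Sum.inl i) j = if j = Sum.inl i then 1 - α * T else 0 := by
  rcases j with j | j
  · by_cases hj : j = i
    · simp [Rmat, diagN, hj]
    · simp [Rmat, diagN, hj, Ne.symm hj]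
  · simp [Rmat, diagN]

theorem Phi1_inl_apply {nN nM : ℕ} (T α : ℝ) (LN : Matrix (Fin nN) (Fin nN ⊕ Fin nM) ℝ)
    (i : Fin nN) (j : Fin nN ⊕ Fin nM) :
    Phi1 T α LN (Sum.inl i) j =
      (if j = Sum.inl i then 2 - α * T else 0) - T ^ 2 / 2 * LN i j := by
  simp only [Phi1, LNfull, Matrix.sub_apply, Matrix.add_apply, Matrix.smul_apply,
    Rmat_inl_apply, Matrix.one_apply, eq_comm (a := Sum.inl i), Matrix.fromRows_apply_inl,
    smul_eq_mul]
  split_ifs <;> ring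

theorem Phi2_inl_apply {nN nM : ℕ} (T α : ℝ) (LN : Matrix (Fin nN) (Fin nN ⊕ Fin nM) ℝ)
    (i : Fin nN) (j : Fin nN ⊕ Fin nM) :
    Phi2 T α LN (Sum.inl i) j =
      (if j = Sum.inl i then α * T - 1 else 0) - T ^ 2 / 2 * LN i j := by
  simp only [Phi2, LNfull, Matrix.sub_apply, Matrix.neg_apply, Matrix.smul_apply,
    Rmat_inl_apply, Matrix.fromRows_apply_inl, smul_eq_mul]
  split_ifs <;> ring

/-- if `L^N[k]` and `L^N[k−1]` consist of the first `n_N` rows of weighted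
graph Laplacians (weights in `{0} ∪ [γ,1)`, `γ > 0`, row sums at most 1) and
`1 + T²/2 ≤ αT ≤ 2 − T²/2`, then each of the first `n_N` rows of the `n×2n` matrix
`[Φ_{1k} Φ_{2k}]` is entrywise nonnegative and sums to one. -/
theorem phi_rows_nonneg_stochastic (nN nM : ℕ) (T α γ : ℝ)
    (hT : 0 < T) (hγ : 0 < γ)
    (hαT1 : 1 + T ^ 2 / 2 ≤ α * T) (hαT2 : α * T ≤ 2 - T ^ 2 / 2)
    (LNk LNk1 : Matrix (Fin nN) (Fin nN ⊕ Fin nM) ℝ)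
    (hLk : IsLaplacianRows γ LNk) (hLk1 : IsLaplacianRows γ LNk1) :
    ∀ i : Fin nN,
      (∀ j, 0 ≤ Phi1 T α LNk (Sum.inl i) j) ∧
      (∀ j, 0 ≤ Phi2 T α LNk1 (Sum.inl i) j) ∧
      (∑ j, Phi1 T α LNk (Sum.inl i) j) + (∑ j, Phi2 T α LNk1 (Sum.inl i) j) = 1 := by
  intro i
  simp only [Phi1_inl_apply, Phi2_inl_apply, hLk.sum_scalar_sub, hLk1.sum_scalar_sub]
  exact ⟨hLk.scalar_sub_nonneg hγ (by positivity) (by linarith) i,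
    hLk1.scalar_sub_nonneg hγ (by positivity) (by linarith) i, by ring⟩
end

section
/- Under the f-total malicious model (with any underlying digraph, no robustness assumption), the synchronous DP-MSR algorithm guarantees the safety condition: for all k ≥ 0 and every normal agent i, x̂_i[k] ∈ S, where S = [min_i x̂_i[0] + min{0, min_i (T−αT²/2)v_i[0]}, max_i x̂_i[0] + max{0, max_i (T−αT²/2)v_i[0]}] with minima and maxima taken over the normal agents. -/
open Finset Filter

/-- DP-MSR filtered weights: given the relative values `rel j` of the neighbors of
agent `i`, the weight function `a` is admissible if, after ignoring (setting weight 0)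
the `f` neighbors with largest relative values when at least `f` of them are `≥ 0`
(all neighbors with values `≥ 0` otherwise), and similarly the `f` neighbors with
smallest relative values when at least `f` of them are `≤ 0` (all with values `≤ 0`
otherwise), the weights of the remaining neighbors lie in `[γ,1)`, non-neighbors get
weight 0, and the weights sum to at most 1. -/
def MSRWeights {n : ℕ} (E : Finset (Fin n × Fin n)) (f : ℕ) (γ : ℝ)
    (i : Fin n) (rel : Fin n → ℝ) (a : Fin n → ℝ) : Prop :=
  ∃ Fup Fdn : Finset (Fin n), Fup ⊆ inNbr E i ∧ Fdn ⊆ inNbr E i ∧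
    (if f ≤ ((inNbr E i).filter fun j => 0 ≤ rel j).card
      then Fup.card = f ∧ ∀ j ∈ Fup, ∀ j' ∈ inNbr E i \ Fup, rel j' ≤ rel j
      else Fup = (inNbr E i).filter fun j => 0 ≤ rel j) ∧
    (if f ≤ ((inNbr E i).filter fun j => rel j ≤ 0).card
      then Fdn.card = f ∧ ∀ j ∈ Fdn, ∀ j' ∈ inNbr E i \ Fdn, rel j ≤ rel j'
      else Fdn = (inNbr E i).filter fun j => rel j ≤ 0) ∧
    (∀ j, j ∉ inNbr E i → a j = 0) ∧
    (∀ j ∈ Fup ∪ Fdn, a j = 0) ∧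
    (∀ j ∈ (inNbr E i) \ (Fup ∪ Fdn), γ ≤ a j ∧ a j < 1) ∧
    (∑ j ∈ inNbr E i, a j) ≤ 1

/-- Sampled-data double-integrator dynamics for all agents. -/
def SyncDynamics {n : ℕ} (T : ℝ) (x v u : ℕ → Fin n → ℝ) : Prop :=
  ∀ k i, x (k + 1) i = x k i + T * v k i + T ^ 2 / 2 * u k i ∧
         v (k + 1) i = v k i + T * u k i

/-- Every normal agent (not in `M`) applies the synchronous DP-MSR control law. -/
def SyncDPMSR {n : ℕ} (E : Finset (Fin n × Fin n)) (f : ℕ) (γ α : ℝ)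
    (M : Finset (Fin n)) (x v u : ℕ → Fin n → ℝ) : Prop :=
  ∀ k, ∀ i ∉ M, ∃ a : Fin n → ℝ,
    MSRWeights E f γ i (fun j => x k j - x k i) a ∧
    u k i = (∑ j ∈ inNbr E i, a j * (x k j - x k i)) - α * v k i

/-- Lower end of the safety interval `S`: `min_i x̂_i[0] + min{0, min_i (T−αT²/2)v_i[0]}`,
minima over the normal agents. -/
noncomputable def safetyLo {n : ℕ} (M : Finset (Fin n)) (T α : ℝ)
    (x0 v0 : Fin n → ℝ) : ℝ :=
  sInf {y : ℝ | ∃ i ∉ M, y = x0 i} +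
    min 0 (sInf {y : ℝ | ∃ i ∉ M, y = (T - α * T ^ 2 / 2) * v0 i})

/-- Upper end of the safety interval `S`: `max_i x̂_i[0] + max{0, max_i (T−αT²/2)v_i[0]}`,
maxima over the normal agents. -/
noncomputable def safetyHi {n : ℕ} (M : Finset (Fin n)) (T α : ℝ)
    (x0 v0 : Fin n → ℝ) : ℝ :=
  sSup {y : ℝ | ∃ i ∉ M, y = x0 i} +
    max 0 (sSup {y : ℝ | ∃ i ∉ M, y = (T - α * T ^ 2 / 2) * v0 i})

/-- The filtering rule is symmetric under reversal of the sign of the relative values. -/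
theorem MSRWeights.neg {n : ℕ} {E : Finset (Fin n × Fin n)} {f : ℕ} {γ : ℝ} {i : Fin n}
    {rel a : Fin n → ℝ} (h : MSRWeights E f γ i rel a) :
    MSRWeights E f γ i (fun j => -rel j) a := by
  obtain ⟨Fup, Fdn, hup, hdn, hU, hD, h0, hF, hR, hsum⟩ := h
  refine ⟨Fdn, Fup, hdn, hup, ?_, ?_, h0, ?_, ?_, hsum⟩
  · simpa only [Left.nonneg_neg_iff, neg_le_neg_iff] using hD
  · simpa only [Left.neg_nonpos_iff, neg_le_neg_iff] using hU
  · rwa [Finset.union_comm]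
  · rwa [Finset.union_comm]

/-- Weights that survive the filtering are nonnegative. -/
theorem MSRWeights.nonneg {n : ℕ} {E : Finset (Fin n × Fin n)} {f : ℕ} {γ : ℝ} {i : Fin n}
    {rel a : Fin n → ℝ} (h : MSRWeights E f γ i rel a) (hγ : 0 < γ) (j : Fin n) : 0 ≤ a j := by
  obtain ⟨Fup, Fdn, -, -, -, -, h0, hF, hR, -⟩ := h
  by_cases hj : j ∈ inNbr E i
  · by_cases hjF : j ∈ Fup ∪ Fdn
    · exact (hF j hjF).ge
    · exact hγ.le.trans (hR j (Finset.mem_sdiff.2 ⟨hj, hjF⟩)).1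
  · exact (h0 j hj).ge

/-- With at most `f` malicious agents, a neighbor strictly above a nonnegative bound valid for
all normal agents is filtered out. -/
theorem MSRWeights.eq_zero_of_lt {n : ℕ} {E : Finset (Fin n × Fin n)} {f : ℕ} {γ : ℝ} {i : Fin n}
    {rel a : Fin n → ℝ} (h : MSRWeights E f γ i rel a) {M : Finset (Fin n)} (hM : M.card ≤ f)
    {c : ℝ} (hc : 0 ≤ c) (hrel : ∀ j ∉ M, rel j ≤ c) {j : Fin n} (hj : c < rel j) : a j = 0 := by
  obtain ⟨Fup, Fdn, -, -, hU, -, h0, hF, -, -⟩ := h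
  by_cases hjN : j ∈ inNbr E i
  swap
  · exact h0 j hjN
  refine hF j (Finset.mem_union_left _ ?_)
  by_contra hjF
  split_ifs at hU
  · have hsub : insert j Fup ⊆ M := by
      intro l hl
      by_contra hlM
      refine absurd (hrel l hlM) (not_le.2 ?_)
      rcases Finset.mem_insert.1 hl with rfl | hl
      · exact hj
      · exact hj.trans_le (hU.2 l hl j (Finset.mem_sdiff.2 ⟨hjN, hjF⟩))
    have hcard := Finset.card_le_card hsub
    rw [Finset.card_insert_of_notMem hjF, hU.1] at hcard
    omega
  · rw [hU] at hjF
    exact hjF (Finset.mem_filter.2 ⟨hjN, hc.trans hj.le⟩)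

/-- The weighted sum of filtered relative values respects bounds valid for all normal agents. -/
theorem MSRWeights.sum_le {n : ℕ} {E : Finset (Fin n × Fin n)} {f : ℕ} {γ : ℝ} {i : Fin n}
    {rel a : Fin n → ℝ} (h : MSRWeights E f γ i rel a) (hγ : 0 < γ) {M : Finset (Fin n)}
    (hM : M.card ≤ f) {c : ℝ} (hc : 0 ≤ c) (hrel : ∀ j ∉ M, rel j ≤ c) :
    ∑ j ∈ inNbr E i, a j * rel j ≤ c := by
  have hsum : ∑ j ∈ inNbr E i, a j ≤ 1 := by
    obtain ⟨-, -, -, -, -, -, -, -, -, hsum⟩ := h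
    exact hsum
  calc ∑ j ∈ inNbr E i, a j * rel j ≤ ∑ j ∈ inNbr E i, a j * c := by
        refine Finset.sum_le_sum fun j _ => ?_
        rcases le_or_gt (rel j) c with hj | hj
        · exact mul_le_mul_of_nonneg_left hj (h.nonneg hγ j)
        · simp [h.eq_zero_of_lt hM hc hrel hj]
    _ = (∑ j ∈ inNbr E i, a j) * c := (Finset.sum_mul ..).symm
    _ ≤ c := mul_le_of_le_one_left hc hsum

theorem SyncDynamics.neg {n : ℕ} {T : ℝ} {x v u : ℕ → Fin n → ℝ} (h : SyncDynamics T x v u) :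
    SyncDynamics T (-x) (-v) (-u) := by
  intro k i
  obtain ⟨hx, hv⟩ := h k i
  simp only [Pi.neg_apply, hx, hv]
  constructor <;> ring

theorem SyncDPMSR.neg {n : ℕ} {E : Finset (Fin n × Fin n)} {f : ℕ} {γ α : ℝ}
    {M : Finset (Fin n)} {x v u : ℕ → Fin n → ℝ} (h : SyncDPMSR E f γ α M x v u) :
    SyncDPMSR E f γ α M (-x) (-v) (-u) := by
  intro k i hi
  obtain ⟨a, ha, hu⟩ := h k i hi
  have hrel : ∀ j, (-x) k j - (-x) k i = -(x k j - x k i) := fun j => by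
    simp only [Pi.neg_apply]; ring
  refine ⟨a, ?_, ?_⟩
  · simpa only [hrel] using ha.neg
  · simp only [hrel, mul_neg, Finset.sum_neg_distrib]
    simp only [Pi.neg_apply, hu]
    ring

/-- One-sided safety: an upper bound on the initial normal positions, enlarged by a nonnegative
bound on the initial velocity terms, bounds the normal positions at all times. -/
theorem SyncDPMSR.le_add {n : ℕ} {E : Finset (Fin n × Fin n)} {f : ℕ} {T α γ : ℝ} (hγ : 0 < γ)
    (hαT1 : 1 + T ^ 2 / 2 ≤ α * T) (hαT2 : α * T ≤ 2 - T ^ 2 / 2)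
    {M : Finset (Fin n)} (hM : M.card ≤ f) {x v u : ℕ → Fin n → ℝ}
    (hdyn : SyncDynamics T x v u) (hmsr : SyncDPMSR E f γ α M x v u) {A B : ℝ} (hB : 0 ≤ B)
    (hx0 : ∀ i ∉ M, x 0 i ≤ A) (hv0 : ∀ i ∉ M, (T - α * T ^ 2 / 2) * v 0 i ≤ B) :
    ∀ k, ∀ i ∉ M, x k i ≤ A + B := by
  have hT2 : 0 ≤ T ^ 2 / 2 := by positivity
  -- the consensus term of the control input
  let s : ℕ → Fin n → ℝ := fun k i => u k i + α * v k i
  have hs : ∀ k c, (∀ j ∉ M, x k j ≤ c) → ∀ i ∉ M, s k i ≤ c - x k i := by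
    intro k c hc i hi
    obtain ⟨a, ha, hu⟩ := hmsr k i hi
    have hle := ha.sum_le hγ hM (sub_nonneg.2 (hc i hi))
      (fun j hj => sub_le_sub_right (hc j hj) _)
    simp only [s, hu]
    linarith
  have hstep : ∀ k i, x (k + 1) i =
      x k i + T ^ 2 / 2 * s k i + (T - α * T ^ 2 / 2) * v k i := by
    intro k i
    rw [(hdyn k i).1]
    simp only [s]
    ring
  have hstep2 : ∀ k i, x (k + 2) i = (2 - α * T) * x (k + 1) i + T ^ 2 / 2 * s (k + 1) i +
      ((α * T - 1) * x k i + T ^ 2 / 2 * s k i) := by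
    intro k i
    have h1 := hstep (k + 1) i
    rw [(hdyn k i).2] at h1
    have h2 := hstep k i
    have h3 : u k i = s k i - α * v k i := by simp [s]
    rw [h3] at h1
    linear_combination h1 - (1 - α * T) * h2
  have hcomb : ∀ p k c, T ^ 2 / 2 ≤ p → (∀ j ∉ M, x k j ≤ c) → ∀ i ∉ M,
      p * x k i + T ^ 2 / 2 * s k i ≤ p * c := by
    intro p k c hp hc i hi
    have h1 := mul_le_mul_of_nonneg_left (hs k c hc i hi) hT2
    have h2 := mul_le_mul_of_nonneg_left (hc i hi) (sub_nonneg.2 hp)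
    linarith
  have key : ∀ k, (∀ i ∉ M, x k i ≤ A + B) ∧ ∀ i ∉ M, x (k + 1) i ≤ A + B := by
    intro k
    induction k with
    | zero =>
      refine ⟨fun i hi => (hx0 i hi).trans (le_add_of_nonneg_right hB), fun i hi => ?_⟩
      have h1 := hcomb 1 0 A (by linarith) hx0 i hi
      have h2 := hv0 i hi
      rw [hstep]
      linarith
    | succ k ih =>
      refine ⟨ih.2, fun i hi => ?_⟩
      have h1 := hcomb (2 - α * T) (k + 1) _ (by linarith) ih.2 i hi
      have h2 := hcomb (α * T - 1) k _ (by linarith) ih.1 i hi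
      rw [hstep2]
      linarith
  exact fun k => (key k).1

theorem finite_setOf_exists_notMem_eq {n : ℕ} (M : Finset (Fin n)) (g : Fin n → ℝ) :
    {y : ℝ | ∃ i ∉ M, y = g i}.Finite := by
  refine (Set.finite_range g).subset ?_
  rintro y ⟨i, -, rfl⟩
  exact Set.mem_range_self i

/-- safety, synchronous: under the `f`-total malicious model (no
robustness assumption on the digraph), the synchronous DP-MSR algorithm guarantees
that every normal position stays in `S = [safetyLo, safetyHi]` for all `k ≥ 0`. -/
theorem dpmsr_safety_f_total {n : ℕ} (hn : 1 < n) (E : Finset (Fin n × Fin n))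
    (f : ℕ) (T α γ : ℝ) (hT : 0 < T) (hγ : 0 < γ)
    (hαT1 : 1 + T ^ 2 / 2 ≤ α * T) (hαT2 : α * T ≤ 2 - T ^ 2 / 2)
    (M : Finset (Fin n)) (hM : M.card ≤ f) (hNormal : ∃ i, i ∉ M)
    (x v u : ℕ → Fin n → ℝ)
    (hdyn : SyncDynamics T x v u)
    (hmsr : SyncDPMSR E f γ α M x v u) :
    ∀ k, ∀ i ∉ M,
      safetyLo M T α (x 0) (v 0) ≤ x k i ∧ x k i ≤ safetyHi M T α (x 0) (v 0) := by
  have hSup (g : Fin n → ℝ) (i : Fin n) (hi : i ∉ M) : g i ≤ sSup {y : ℝ | ∃ i ∉ M, y = g i} :=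
    le_csSup (finite_setOf_exists_notMem_eq M g).bddAbove ⟨i, hi, rfl⟩
  have hInf (g : Fin n → ℝ) (i : Fin n) (hi : i ∉ M) : sInf {y : ℝ | ∃ i ∉ M, y = g i} ≤ g i :=
    csInf_le (finite_setOf_exists_notMem_eq M g).bddBelow ⟨i, hi, rfl⟩
  refine fun k i hi => ⟨?_, ?_⟩
  · have h := hmsr.neg.le_add hγ hαT1 hαT2 hM hdyn.neg
      (A := -sInf {y : ℝ | ∃ i ∉ M, y = x 0 i})
      (B := -min 0 (sInf {y : ℝ | ∃ i ∉ M, y = (T - α * T ^ 2 / 2) * v 0 i}))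
      (neg_nonneg.2 (min_le_left _ _))
      (fun j hj => neg_le_neg (hInf (x 0) j hj))
      (fun j hj => by
        have := (min_le_right 0 _).trans (hInf (fun i => (T - α * T ^ 2 / 2) * v 0 i) j hj)
        simpa only [Pi.neg_apply, mul_neg] using neg_le_neg this) k i hi
    simp only [Pi.neg_apply] at h
    unfold safetyLo
    linarith
  · exact hmsr.le_add hγ hαT1 hαT2 hM hdyn (le_max_left _ _) (hSup (x 0))
      (fun j hj => (hSup (fun i => (T - α * T ^ 2 / 2) * v 0 i) j hj).trans (le_max_right _ _))
      k i hi
end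

section
/- Under the f-total malicious model with partially asynchronous updates and time-varying delays bounded by τ, if the network of second-order agents running the asynchronous DP-MSR algorithm reaches resilient consensus for every admissible delay pattern and malicious behavior, then the underlying digraph is (f+1,f+1)-robust. Equivalently, if the graph is not (f+1,f+1)-robust, there exist at most f malicious agents, initial conditions, delays (in particular all delays zero), and malicious inputs under which the normal agents' positions fail to reach agreement. -/
open Finset Filter

/-- Sampled-data double-integrator dynamics for all agents, running from time 0
(times are integers so that the initial position history over `0, −1, …, −τ` is
available). -/
def Dynamics {n : ℕ} (T : ℝ) (x v u : ℤ → Fin n → ℝ) : Prop :=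
  ∀ k : ℤ, 0 ≤ k → ∀ i,
    x (k + 1) i = x k i + T * v k i + T ^ 2 / 2 * u k i ∧
    v (k + 1) i = v k i + T * u k i

/-- Every normal agent (not in `M`) applies the partially asynchronous DP-MSR control
law with delayed relative positions `x̂_j[k−τ_{ij}[k]] − x̂_i[k]` (delays `d`) and its
own current velocity. -/
def AsyncDPMSR {n : ℕ} (E : Finset (Fin n × Fin n)) (f : ℕ) (γ α : ℝ)
    (M : Finset (Fin n)) (d : ℤ → Fin n → Fin n → ℕ)
    (x v u : ℤ → Fin n → ℝ) : Prop :=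
  ∀ k : ℤ, 0 ≤ k → ∀ i ∉ M, ∃ a : Fin n → ℝ,
    MSRWeights E f γ i (fun j => x (k - (d k i j : ℤ)) j - x k i) a ∧
    u k i = (∑ j ∈ inNbr E i, a j * (x (k - (d k i j : ℤ)) j - x k i)) - α * v k i

/-- Lower end of the safety interval `S_τ`:
`min z^N[0] + min{0, min_i (T−αT²/2)v_i[0]}`, where `z^N[0]` collects the normal
agents' initial position history over times `0, −1, …, −τ`. -/
noncomputable def safetyLoTau {n : ℕ} (M : Finset (Fin n)) (τ : ℕ) (T α : ℝ)
    (x : ℤ → Fin n → ℝ) (v : ℤ → Fin n → ℝ) : ℝ :=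
  sInf {y : ℝ | ∃ i ∉ M, ∃ ℓ : ℕ, ℓ ≤ τ ∧ y = x (-(ℓ : ℤ)) i} +
    min 0 (sInf {y : ℝ | ∃ i ∉ M, y = (T - α * T ^ 2 / 2) * v 0 i})

/-- Upper end of the safety interval `S_τ`:
`max z^N[0] + max{0, max_i (T−αT²/2)v_i[0]}`. -/
noncomputable def safetyHiTau {n : ℕ} (M : Finset (Fin n)) (τ : ℕ) (T α : ℝ)
    (x : ℤ → Fin n → ℝ) (v : ℤ → Fin n → ℝ) : ℝ :=
  sSup {y : ℝ | ∃ i ∉ M, ∃ ℓ : ℕ, ℓ ≤ τ ∧ y = x (-(ℓ : ℤ)) i} +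
    max 0 (sSup {y : ℝ | ∃ i ∉ M, y = (T - α * T ^ 2 / 2) * v 0 i})

/-- A finset of size at least `f` has an `f`-element subset of elements with largest values. -/
theorem exists_top_subset {ι : Type*} [DecidableEq ι] (rel : ι → ℝ) (s : Finset ι) :
    ∀ f : ℕ, f ≤ s.card →
      ∃ F ⊆ s, F.card = f ∧ ∀ j ∈ F, ∀ j' ∈ s \ F, rel j' ≤ rel j := by
  intro f
  induction f with
  | zero => intro _; exact ⟨∅, by simp⟩
  | succ f ih =>
    intro hf
    obtain ⟨F, hFs, hFc, hF⟩ := ih (by omega)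
    have hne : (s \ F).Nonempty := by
      rw [← Finset.card_pos, Finset.card_sdiff_of_subset hFs]
      omega
    obtain ⟨m, hm, hmax⟩ := Finset.exists_max_image (s \ F) rel hne
    have hm' := Finset.mem_sdiff.1 hm
    refine ⟨insert m F, Finset.insert_subset hm'.1 hFs, ?_, ?_⟩
    · rw [Finset.card_insert_of_notMem hm'.2, hFc]
    · intro j hj j' hj'
      have hj'' : j' ∈ s \ F := by
        simp only [Finset.mem_sdiff, Finset.mem_insert, not_or] at hj' ⊢
        exact ⟨hj'.1, hj'.2.2⟩
      rcases Finset.mem_insert.1 hj with rfl | hj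
      · exact hmax j' hj''
      · exact hF j hj j' hj''

/-- The set of neighbors discarded on the upper side exists. -/
theorem exists_upper_filter {ι : Type*} [DecidableEq ι] (rel : ι → ℝ) (s : Finset ι)
    (f : ℕ) : ∃ F ⊆ s,
      if f ≤ (s.filter fun j => 0 ≤ rel j).card
        then F.card = f ∧ ∀ j ∈ F, ∀ j' ∈ s \ F, rel j' ≤ rel j
        else F = s.filter fun j => 0 ≤ rel j := by
  split_ifs with h
  · exact exists_top_subset rel s f (h.trans (Finset.card_filter_le _ _))
  · exact ⟨_, Finset.filter_subset _ _, rfl⟩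

/-- If at most `f` values are nonzero, the upper filter discards every positive one. -/
theorem mem_upper_filter {ι : Type*} [DecidableEq ι] {rel : ι → ℝ} {s F : Finset ι}
    {f : ℕ} (hFs : F ⊆ s)
    (hF : if f ≤ (s.filter fun j => 0 ≤ rel j).card
      then F.card = f ∧ ∀ j ∈ F, ∀ j' ∈ s \ F, rel j' ≤ rel j
      else F = s.filter fun j => 0 ≤ rel j)
    (hcard : (s.filter fun j => rel j ≠ 0).card ≤ f) {j : ι} (hj : j ∈ s)
    (hpos : 0 < rel j) : j ∈ F := by
  split_ifs at hF with h
  · by_contra hjF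
    have hsub : insert j F ⊆ s.filter fun j => rel j ≠ 0 := by
      intro m hm
      rcases Finset.mem_insert.1 hm with rfl | hm
      · exact Finset.mem_filter.2 ⟨hj, hpos.ne'⟩
      · have := hF.2 m hm j (Finset.mem_sdiff.2 ⟨hj, hjF⟩)
        exact Finset.mem_filter.2 ⟨hFs hm, (hpos.trans_le this).ne'⟩
    have := Finset.card_le_card hsub
    rw [Finset.card_insert_of_notMem hjF, hF.1] at this
    omega
  · rw [hF]
    exact Finset.mem_filter.2 ⟨hj, hpos.le⟩

/-- Admissible filtered weights exist as soon as `γ` is small enough. -/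
theorem exists_msrWeights {n : ℕ} (hn : 1 < n) (E : Finset (Fin n × Fin n)) (f : ℕ)
    {γ : ℝ} (hγ : 0 < γ) (hγn : γ * n ≤ 1) (i : Fin n) (rel : Fin n → ℝ) :
    ∃ a, MSRWeights E f γ i rel a := by
  obtain ⟨Fup, hup, hFup⟩ := exists_upper_filter rel (inNbr E i) f
  obtain ⟨Fdn, hdn, hFdn⟩ := exists_upper_filter (fun j => -rel j) (inNbr E i) f
  have hγ1 : γ < 1 := by
    have : (1 : ℝ) < n := by exact_mod_cast hn
    nlinarith
  refine ⟨fun j => if j ∈ inNbr E i \ (Fup ∪ Fdn) then γ else 0,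
    Fup, Fdn, hup, hdn, hFup, ?_, ?_, ?_, ?_, ?_⟩
  · simpa only [Left.nonneg_neg_iff, neg_le_neg_iff] using hFdn
  · intro j hj
    simp [hj]
  · intro j hj
    exact if_neg fun h => (Finset.mem_sdiff.1 h).2 hj
  · intro j hj
    simp only [if_pos hj]
    exact ⟨le_rfl, hγ1⟩
  · calc (∑ j ∈ inNbr E i, if j ∈ inNbr E i \ (Fup ∪ Fdn) then γ else 0)
        ≤ ∑ _j ∈ inNbr E i, γ := by
          refine Finset.sum_le_sum fun j _ => ?_
          split_ifs
          · exact le_rfl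
          · exact hγ.le
      _ = (inNbr E i).card * γ := by rw [Finset.sum_const, nsmul_eq_mul]
      _ ≤ n * γ := by
          refine mul_le_mul_of_nonneg_right ?_ hγ.le
          exact_mod_cast (Finset.card_le_univ _).trans_eq (Fintype.card_fin n)
      _ ≤ 1 := by rwa [mul_comm]

/-- If at most `f` neighbors have a nonzero relative value, filtering cancels all of them. -/
theorem MSRWeights.sum_mul_eq_zero {n : ℕ} {E : Finset (Fin n × Fin n)} {f : ℕ} {γ : ℝ}
    {i : Fin n} {rel a : Fin n → ℝ} (h : MSRWeights E f γ i rel a)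
    (hcard : ((inNbr E i).filter fun j => rel j ≠ 0).card ≤ f) :
    ∑ j ∈ inNbr E i, a j * rel j = 0 := by
  obtain ⟨Fup, Fdn, hup, hdn, hFup, hFdn, -, ha, -, -⟩ := h
  refine Finset.sum_eq_zero fun j hj => ?_
  rcases lt_trichotomy (rel j) 0 with hneg | hzero | hpos
  · have : j ∈ Fdn := by
      refine mem_upper_filter (rel := fun j => -rel j) (f := f) hdn ?_ ?_ hj (neg_pos.2 hneg)
      · simpa only [Left.nonneg_neg_iff, neg_le_neg_iff] using hFdn
      · simpa only [ne_eq, neg_eq_zero] using hcard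
    rw [ha j (Finset.mem_union_right _ this), zero_mul]
  · rw [hzero, mul_zero]
  · rw [ha j (Finset.mem_union_left _ (mem_upper_filter hup hFup hcard hj hpos)), zero_mul]

/-- A node of `S \ XSet E (f + 1) S` sees at most `f` values different from its own when the
nodes of `S` agree. -/
theorem card_filter_ne_le_of_notMem_XSet {n : ℕ} {E : Finset (Fin n × Fin n)} {f : ℕ}
    {S : Finset (Fin n)} {i : Fin n} (hi : i ∈ S) (hiX : i ∉ XSet E (f + 1) S)
    {y : Fin n → ℝ} {c : ℝ} (hy : ∀ j ∈ S, y j = c) :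
    ((inNbr E i).filter fun j => y j - y i ≠ 0).card ≤ f := by
  have hlt : (inNbr E i \ S).card < f + 1 := by
    by_contra hge
    exact hiX (Finset.mem_filter.2 ⟨hi, not_lt.1 hge⟩)
  refine (Finset.card_le_card fun j hj => ?_).trans (Nat.lt_succ_iff.1 hlt)
  obtain ⟨hjN, hj⟩ := Finset.mem_filter.1 hj
  refine Finset.mem_sdiff.2 ⟨hjN, fun hjS => hj ?_⟩
  rw [hy j hjS, hy i hi, sub_self]

/-- One sampling step of the double integrators under the state feedback `ctrl`; the state is
the pair of positions and velocities. -/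
noncomputable def doubleIntegratorStep {n : ℕ} (T : ℝ)
    (ctrl : (Fin n → ℝ) × (Fin n → ℝ) → Fin n → ℝ)
    (s : (Fin n → ℝ) × (Fin n → ℝ)) : (Fin n → ℝ) × (Fin n → ℝ) :=
  (fun i => s.1 i + T * s.2 i + T ^ 2 / 2 * ctrl s i, fun i => s.2 i + T * ctrl s i)

/-- A group of agents at rest at a common position stays there if the feedback vanishes on it
in every such state. -/
theorem iterate_doubleIntegratorStep_rest {n : ℕ} {T : ℝ}
    {ctrl : (Fin n → ℝ) × (Fin n → ℝ) → Fin n → ℝ} {S : Finset (Fin n)} {c : ℝ}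
    (hctrl : ∀ s, (∀ i ∈ S, s.1 i = c ∧ s.2 i = 0) → ∀ i ∈ S, ctrl s i = 0)
    {s₀ : (Fin n → ℝ) × (Fin n → ℝ)} (h₀ : ∀ i ∈ S, s₀.1 i = c ∧ s₀.2 i = 0) (k : ℕ) :
    ∀ i ∈ S, ((doubleIntegratorStep T ctrl)^[k] s₀).1 i = c ∧
      ((doubleIntegratorStep T ctrl)^[k] s₀).2 i = 0 := by
  induction k with
  | zero => exact h₀
  | succ k ih =>
    intro i hi
    rw [Function.iterate_succ_apply']
    simp [doubleIntegratorStep, hctrl _ ih i hi, ih i hi]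

/-- necessity, asynchronous: under the `f`-total malicious model with
partially asynchronous updates and delays bounded by `τ`, if the digraph is not
`(f+1,f+1)`-robust then resilient consensus can fail: there exist a malicious set of
at most `f` agents, a trajectory of the asynchronous DP-MSR algorithm (here with all
delays equal to zero, an admissible delay pattern) along which the normal agents'
positions do not converge to a common value. (Equivalently, if consensus is reached
for every admissible delay pattern and malicious behavior, the graph must be
`(f+1,f+1)`-robust.) The hypothesis `γ·n ≤ 1` makes the weight assignment
`a_{ij} ∈ [γ,1)`, `Σ_j a_{ij} ≤ 1` feasible. -/
theorem async_dpmsr_necessity {n : ℕ} (hn : 1 < n) (E : Finset (Fin n × Fin n))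
    (f τ : ℕ) (T α γ : ℝ) (hT : 0 < T) (hγ : 0 < γ) (hγn : γ * n ≤ 1)
    (hαT1 : 1 + T ^ 2 / 2 ≤ α * T) (hαT2 : α * T ≤ 2 - T ^ 2 / 2)
    (hnotrob : ¬ IsRSRobust E (f + 1) (f + 1)) :
    ∃ M : Finset (Fin n), M.card ≤ f ∧
    ∃ x v u : ℤ → Fin n → ℝ,
      Dynamics T x v u ∧
      AsyncDPMSR E f γ α M (fun _ _ _ => 0) x v u ∧
      ¬ ∃ c : ℝ, ∀ i ∉ M,
          Filter.Tendsto (fun k : ℤ => x k i) Filter.atTop (nhds c) := by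
  simp only [IsRSRobust, not_forall, not_or, not_le] at hnotrob
  obtain ⟨S1, S2, -, -, hdisj, hX1, hX2, hcard⟩ := hnotrob
  have hsub1 : XSet E (f + 1) S1 ⊆ S1 := Finset.filter_subset _ _
  have hsub2 : XSet E (f + 1) S2 ⊆ S2 := Finset.filter_subset _ _
  choose w hw using fun i rel => exists_msrWeights hn E f hγ hγn i rel
  let M := XSet E (f + 1) S1 ∪ XSet E (f + 1) S2
  let ctrl : (Fin n → ℝ) × (Fin n → ℝ) → Fin n → ℝ := fun s i =>
    if i ∈ M then 0 else
      (∑ j ∈ inNbr E i, w i (fun j => s.1 j - s.1 i) j * (s.1 j - s.1 i)) - α * s.2 i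
  let s₀ : (Fin n → ℝ) × (Fin n → ℝ) := (fun i => if i ∈ S1 then 0 else 1, fun _ => 0)
  let st : ℤ → (Fin n → ℝ) × (Fin n → ℝ) :=
    fun k => (doubleIntegratorStep T ctrl)^[k.toNat] s₀
  have hrest : ∀ S : Finset (Fin n), XSet E (f + 1) S ⊆ M → ∀ c : ℝ,
      (∀ i ∈ S, s₀.1 i = c ∧ s₀.2 i = 0) → ∀ k, ∀ i ∈ S, (st k).1 i = c := by
    intro S hS c h₀ k i hi
    refine (iterate_doubleIntegratorStep_rest (fun s hs i hi => ?_) h₀ k.toNat i hi).1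
    by_cases hiM : i ∈ M
    · exact if_pos hiM
    · have hsum := (hw i fun j => s.1 j - s.1 i).sum_mul_eq_zero
        (card_filter_ne_le_of_notMem_XSet hi (fun h => hiM (hS h)) fun j hj => (hs j hj).1)
      simp only [ctrl, if_neg hiM, hsum, (hs i hi).2, mul_zero, sub_zero]
  have h1 := hrest S1 Finset.subset_union_left 0 fun i hi => ⟨if_pos hi, rfl⟩
  have h2 := hrest S2 Finset.subset_union_right 1
    fun i hi => ⟨if_neg (Finset.disjoint_right.1 hdisj hi), rfl⟩
  refine ⟨M, (Finset.card_union_le _ _).trans (Nat.lt_succ_iff.1 hcard), fun k => (st k).1,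
    fun k => (st k).2, fun k => ctrl (st k), ?_, ?_, ?_⟩
  · intro k hk i
    have hst : st (k + 1) = doubleIntegratorStep T ctrl (st k) := by
      simp only [st, Int.toNat_add hk zero_le_one, Int.toNat_one,
        Function.iterate_succ_apply']
    beta_reduce
    rw [hst]
    exact ⟨rfl, rfl⟩
  · intro k _ i hi
    simp only [Nat.cast_zero, sub_zero]
    exact ⟨_, hw i fun j => (st k).1 j - (st k).1 i, if_neg hi⟩
  · rintro ⟨c, hc⟩
    obtain ⟨i1, hi1, hi1X⟩ := Finset.exists_of_ssubset (hsub1.ssubset_of_ne hX1)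
    obtain ⟨i2, hi2, hi2X⟩ := Finset.exists_of_ssubset (hsub2.ssubset_of_ne hX2)
    have hi1M : i1 ∉ M := fun h => (Finset.mem_union.1 h).elim hi1X
      fun h => Finset.disjoint_left.1 hdisj hi1 (hsub2 h)
    have hi2M : i2 ∉ M := fun h => (Finset.mem_union.1 h).elim
      (fun h => Finset.disjoint_left.1 hdisj (hsub1 h) hi2) hi2X
    have hc1 := hc i1 hi1M
    have hc2 := hc i2 hi2M
    simp only [h1 _ i1 hi1] at hc1
    simp only [h2 _ i2 hi2] at hc2
    have e1 := tendsto_nhds_unique hc1 tendsto_const_nhds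
    have e2 := tendsto_nhds_unique hc2 tendsto_const_nhds
    exact zero_ne_one (e1.symm.trans e2)
end

section
/- For every integer f ≥ 1 there exists a digraph that is 2f-robust and has minimum in-degree 2f+1, together with a set of at most f malicious agents, initial positions and velocities, a pattern of time-varying delays bounded by τ = 1, and malicious inputs, under which the normal agents running the asynchronous DP-MSR algorithm fail to reach agreement: the normal agents split into two groups whose positions remain at two distinct constant values a < b for all time. One such graph consists of four complete subgraphs G1 (4f agents), G2, G3, G4 (f agents each), where each agent of G2 has incoming links from 2f agents of G1, each agent of G3 has f incoming links from G1 and f from G2, and each agent of G4 has incoming links from all 4f agents of G1 and f from G2; the agents of G2 are malicious and oscillate between positions a and b with delays chosen so that they appear constant at a to G3 and constant at b to G4. -/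
open Finset Filter

/-- The nodes of `Fin n` whose index lies in `[p, q)`. -/
def indexBlock (n p q : ℕ) : Finset (Fin n) :=
  Finset.univ.filter fun j => p ≤ j.val ∧ j.val < q

lemma mem_indexBlock {n p q : ℕ} {j : Fin n} :
    j ∈ indexBlock n p q ↔ p ≤ j.val ∧ j.val < q := by
  simp [indexBlock]

lemma card_indexBlock {n p q : ℕ} (hq : q ≤ n) : (indexBlock n p q).card = q - p := by
  rw [← Finset.card_map Fin.valEmbedding, ← Nat.card_Ico]
  congr 1
  ext m
  simp only [Finset.mem_map, mem_indexBlock, Fin.valEmbedding_apply, Finset.mem_Ico]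
  constructor
  · rintro ⟨j, hj, rfl⟩
    exact hj
  · intro hm
    exact ⟨⟨m, by omega⟩, hm, rfl⟩

/-- Edges of the counterexample digraph. The nodes below `4 * f` form a complete digraph, the
nodes in `[4 * f, 5 * f)` listen to all of them, and the nodes from `5 * f` on listen to the
first `f` nodes, to the nodes in `[4 * f, 5 * f)` and to each other. -/
def splitEdges (f : ℕ) : Finset (Fin (6 * f + 1) × Fin (6 * f + 1)) :=
  Finset.univ.filter fun e => e.1 ≠ e.2 ∧
    ((e.2.val < 5 * f ∧ e.1.val < 4 * f) ∨
      (5 * f ≤ e.2.val ∧ (e.1.val < f ∨ 4 * f ≤ e.1.val)))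

lemma mem_inNbr_splitEdges {f : ℕ} {i j : Fin (6 * f + 1)} :
    j ∈ inNbr (splitEdges f) i ↔ j ≠ i ∧
      ((i.val < 5 * f ∧ j.val < 4 * f) ∨
        (5 * f ≤ i.val ∧ (j.val < f ∨ 4 * f ≤ j.val))) := by
  simp [inNbr, splitEdges]

lemma le_card_inNbr_splitEdges {f : ℕ} (hf : 1 ≤ f) (i : Fin (6 * f + 1)) :
    2 * f + 1 ≤ (inNbr (splitEdges f) i).card := by
  by_cases hi : i.val < 5 * f
  · have hsub : (indexBlock (6 * f + 1) 0 (4 * f)).erase i ⊆ inNbr (splitEdges f) i := by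
      intro j hj
      rw [Finset.mem_erase, mem_indexBlock] at hj
      exact mem_inNbr_splitEdges.2 ⟨hj.1, Or.inl ⟨hi, hj.2.2⟩⟩
    have h1 := Finset.card_le_card hsub
    have h2 := Finset.pred_card_le_card_erase (s := indexBlock (6 * f + 1) 0 (4 * f)) (a := i)
    rw [card_indexBlock (by omega)] at h2
    omega
  · have hsub : indexBlock (6 * f + 1) 0 f ∪
        (indexBlock (6 * f + 1) (4 * f) (6 * f + 1)).erase i ⊆ inNbr (splitEdges f) i := by
      intro j hj
      rw [Finset.mem_union, Finset.mem_erase, mem_indexBlock, mem_indexBlock] at hj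
      rw [mem_inNbr_splitEdges, ne_eq, Fin.ext_iff]
      rw [ne_eq, Fin.ext_iff] at hj
      omega
    have hdisj : Disjoint (indexBlock (6 * f + 1) 0 f)
        ((indexBlock (6 * f + 1) (4 * f) (6 * f + 1)).erase i) := by
      rw [Finset.disjoint_left]
      intro j hj hj'
      rw [Finset.mem_erase, mem_indexBlock] at hj'
      rw [mem_indexBlock] at hj
      omega
    have h1 := Finset.card_le_card hsub
    have h2 := Finset.pred_card_le_card_erase
      (s := indexBlock (6 * f + 1) (4 * f) (6 * f + 1)) (a := i)
    rw [Finset.card_union_of_disjoint hdisj, card_indexBlock (by omega)] at h1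
    rw [card_indexBlock le_rfl] at h2
    omega

/-- A nonempty set of nodes meeting the large complete part in at most `2 * f` nodes has a node
with `2 * f` in-neighbors outside of it. -/
lemma XSet_splitEdges_nonempty {f : ℕ} {S : Finset (Fin (6 * f + 1))} (hS : S.Nonempty)
    (hcard : (indexBlock (6 * f + 1) 0 (4 * f) ∩ S).card ≤ 2 * f) :
    (XSet (splitEdges f) (2 * f) S).Nonempty := by
  by_cases h : ∃ i ∈ S, i.val < 5 * f
  · obtain ⟨i, hiS, hi⟩ := h
    refine ⟨i, Finset.mem_filter.2 ⟨hiS, ?_⟩⟩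
    have hsub : indexBlock (6 * f + 1) 0 (4 * f) \ S ⊆ inNbr (splitEdges f) i \ S := by
      intro j hj
      rw [Finset.mem_sdiff, mem_indexBlock] at hj
      rw [Finset.mem_sdiff, mem_inNbr_splitEdges]
      exact ⟨⟨fun h => hj.2 (h ▸ hiS), Or.inl ⟨hi, hj.1.2⟩⟩, hj.2⟩
    have h1 := Finset.card_le_card hsub
    have h2 := Finset.card_sdiff_add_card_inter (indexBlock (6 * f + 1) 0 (4 * f)) S
    rw [card_indexBlock (by omega)] at h2
    omega
  · push Not at h
    obtain ⟨i, hiS⟩ := hS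
    have hi := h i hiS
    refine ⟨i, Finset.mem_filter.2 ⟨hiS, ?_⟩⟩
    have hsub : indexBlock (6 * f + 1) 0 f ∪ indexBlock (6 * f + 1) (4 * f) (5 * f) ⊆
        inNbr (splitEdges f) i \ S := by
      intro j hj
      rw [Finset.mem_union, mem_indexBlock, mem_indexBlock] at hj
      have hjS : j ∉ S := fun hjS => by
        have := h j hjS
        omega
      rw [Finset.mem_sdiff, mem_inNbr_splitEdges]
      exact ⟨⟨fun h => hjS (h ▸ hiS), Or.inr ⟨hi, by omega⟩⟩, hjS⟩
    have hdisj : Disjoint (indexBlock (6 * f + 1) 0 f)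
        (indexBlock (6 * f + 1) (4 * f) (5 * f)) := by
      rw [Finset.disjoint_left]
      intro j hj hj'
      rw [mem_indexBlock] at hj hj'
      omega
    have h1 := Finset.card_le_card hsub
    rw [Finset.card_union_of_disjoint hdisj, card_indexBlock (by omega),
      card_indexBlock (by omega)] at h1
    omega

lemma isRSRobust_splitEdges (f : ℕ) : IsRSRobust (splitEdges f) (2 * f) 1 := by
  intro S1 S2 h1 h2 hdisj
  refine Or.inr (Or.inr ?_)
  have hle : (indexBlock (6 * f + 1) 0 (4 * f) ∩ S1).card +
      (indexBlock (6 * f + 1) 0 (4 * f) ∩ S2).card ≤ 4 * f := by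
    rw [← Finset.card_union_of_disjoint
      (hdisj.mono Finset.inter_subset_right Finset.inter_subset_right)]
    refine (Finset.card_le_card (Finset.union_subset Finset.inter_subset_left
      Finset.inter_subset_left)).trans ?_
    rw [card_indexBlock (by omega)]
    omega
  by_cases hc : (indexBlock (6 * f + 1) 0 (4 * f) ∩ S1).card ≤ 2 * f
  · have := (XSet_splitEdges_nonempty h1 hc).card_pos
    omega
  · have := (XSet_splitEdges_nonempty h2 (by omega)).card_pos
    omega

/-- If all relative values are nonnegative, and they vanish outside a set of `f` neighbors as well
as on some set of `f` neighbors, then some admissible weights produce a zero weighted sum. -/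
lemma exists_MSRWeights_sum_eq_zero {n f : ℕ} {E : Finset (Fin n × Fin n)} {γ : ℝ} {i : Fin n}
    {rel : Fin n → ℝ} (Fup Fdn : Finset (Fin n)) (hup : Fup ⊆ inNbr E i)
    (hdn : Fdn ⊆ inNbr E i) (hupc : Fup.card = f) (hdnc : Fdn.card = f)
    (hpos : ∀ j ∈ inNbr E i, 0 ≤ rel j) (hzero : ∀ j ∈ inNbr E i, j ∉ Fup → rel j = 0)
    (hdn0 : ∀ j ∈ Fdn, rel j = 0) (hγ : 0 ≤ γ) (hγ1 : γ < 1) (hγn : γ * n ≤ 1) :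
    ∃ a : Fin n → ℝ, MSRWeights E f γ i rel a ∧ ∑ j ∈ inNbr E i, a j * rel j = 0 := by
  refine ⟨fun j => if j ∈ inNbr E i \ (Fup ∪ Fdn) then γ else 0,
    ⟨Fup, Fdn, hup, hdn, ?_, ?_, ?_, ?_, ?_, ?_⟩, ?_⟩
  · rw [if_pos]
    · refine ⟨hupc, fun j hj j' hj' => ?_⟩
      rw [Finset.mem_sdiff] at hj'
      rw [hzero j' hj'.1 hj'.2]
      exact hpos j (hup hj)
    · rw [Finset.filter_true_of_mem hpos, ← hupc]
      exact Finset.card_le_card hup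
  · rw [if_pos]
    · refine ⟨hdnc, fun j hj j' hj' => ?_⟩
      rw [hdn0 j hj]
      exact hpos j' (Finset.mem_sdiff.1 hj').1
    · rw [← hdnc]
      exact Finset.card_le_card fun j hj => Finset.mem_filter.2 ⟨hdn hj, (hdn0 j hj).le⟩
  · intro j hj
    simp [hj]
  · intro j hj
    exact if_neg fun h => (Finset.mem_sdiff.1 h).2 hj
  · intro j hj
    simp only [if_pos hj]
    exact ⟨le_rfl, hγ1⟩
  · calc ∑ j ∈ inNbr E i, (if j ∈ inNbr E i \ (Fup ∪ Fdn) then γ else 0)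
        ≤ ∑ j ∈ inNbr E i, γ := by
          refine Finset.sum_le_sum fun j _ => ?_
          split_ifs
          exacts [le_rfl, hγ]
      _ ≤ ∑ _j : Fin n, γ :=
          Finset.sum_le_sum_of_subset_of_nonneg (Finset.subset_univ _) fun _ _ _ => hγ
      _ ≤ 1 := by
          rw [Finset.sum_const, Finset.card_univ, Fintype.card_fin, nsmul_eq_mul, mul_comm]
          exact hγn
  · refine Finset.sum_eq_zero fun j hj => ?_
    by_cases hju : j ∈ Fup
    · simp [hju]
    · rw [hzero j hj hju, mul_zero]

/-- Positions: `1` below `4 * f`, `0` from `5 * f` on, alternating in between. -/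
noncomputable def splitPos (f : ℕ) (k : ℤ) (i : Fin (6 * f + 1)) : ℝ :=
  if i.val < 4 * f then 1 else if 5 * f ≤ i.val then 0 else if Even k then 0 else 1

/-- Velocities realizing the positions `splitPos` with sampling period `T`. -/
noncomputable def splitVel (f : ℕ) (T : ℝ) (k : ℤ) (i : Fin (6 * f + 1)) : ℝ :=
  if i.val < 4 * f ∨ 5 * f ≤ i.val then 0
  else if Even k then -(2 * k / T) else 2 * k / T

/-- Inputs realizing the velocities `splitVel`. -/
noncomputable def splitInput (f : ℕ) (T : ℝ) (k : ℤ) (i : Fin (6 * f + 1)) : ℝ :=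
  (splitVel f T (k + 1) i - splitVel f T k i) / T

lemma dynamics_split (f : ℕ) {T : ℝ} (hT : T ≠ 0) :
    Dynamics T (splitPos f) (splitVel f T) (splitInput f T) := by
  intro k _ i
  refine ⟨?_, by rw [splitInput]; field_simp; ring⟩
  unfold splitInput splitVel splitPos
  by_cases h1 : i.val < 4 * f
  · simp [h1]
  by_cases h2 : 5 * f ≤ i.val
  · simp [h1, h2]
  simp only [h1, h2, or_self, if_false, Int.even_add_one]
  by_cases hk : Even k
  · simp only [hk, not_true_eq_false, if_true, if_false]
    push_cast
    field_simp
    ring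
  · simp only [hk, not_false_eq_true, if_true, if_false]
    push_cast
    field_simp
    ring

/-- Delays under which the alternating agents appear to stay at `0`. -/
def splitDelay {n : ℕ} (k : ℤ) (_ _ : Fin n) : ℕ := if Even k then 0 else 1

lemma splitPos_sub_splitDelay (f : ℕ) (k : ℤ) (i j : Fin (6 * f + 1)) :
    splitPos f (k - (splitDelay k i j : ℤ)) j = if j.val < 4 * f then 1 else 0 := by
  have heven : Even (k - (splitDelay k i j : ℤ)) := by
    unfold splitDelay
    split_ifs with hk
    · simpa using hk
    · simpa [Int.even_sub_one] using hk
  simp [splitPos, heven]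

lemma asyncDPMSR_split {f : ℕ} (hf : 1 ≤ f) {T α γ : ℝ} (hγ : 0 ≤ γ) (hγ1 : γ < 1)
    (hγn : γ * (6 * f + 1 : ℕ) ≤ 1) :
    AsyncDPMSR (splitEdges f) f γ α (indexBlock (6 * f + 1) (4 * f) (5 * f)) splitDelay
      (splitPos f) (splitVel f T) (splitInput f T) := by
  intro k _ i hi
  rw [mem_indexBlock] at hi
  have hi' : i.val < 4 * f ∨ 5 * f ≤ i.val := by omega
  have hv : ∀ k, splitVel f T k i = 0 := fun k => if_pos hi'
  have hu : splitInput f T k i = 0 := by simp [splitInput, hv]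
  suffices ∃ a : Fin (6 * f + 1) → ℝ, MSRWeights (splitEdges f) f γ i
      (fun j => splitPos f (k - (splitDelay k i j : ℤ)) j - splitPos f k i) a ∧
      ∑ j ∈ inNbr (splitEdges f) i,
        a j * (splitPos f (k - (splitDelay k i j : ℤ)) j - splitPos f k i) = 0 by
    obtain ⟨a, ha, hsum⟩ := this
    exact ⟨a, ha, by rw [hu, hv, hsum]; simp⟩
  simp only [splitPos_sub_splitDelay]
  rcases hi' with hi | hi
  · have hrel : ∀ j ∈ inNbr (splitEdges f) i,
        (if j.val < 4 * f then (1 : ℝ) else 0) - splitPos f k i = 0 := by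
      intro j hj
      rw [mem_inNbr_splitEdges] at hj
      have hj' : j.val < 4 * f := by omega
      simp [splitPos, hi, hj']
    obtain ⟨F, hF, hFc⟩ := Finset.exists_subset_card_eq
      (show f ≤ (inNbr (splitEdges f) i).card from
        le_trans (by omega) (le_card_inNbr_splitEdges hf i))
    exact exists_MSRWeights_sum_eq_zero F F hF hF hFc hFc (fun j hj => (hrel j hj).ge)
      (fun j hj _ => hrel j hj) (fun j hj => hrel j (hF hj)) hγ hγ1 hγn
  · have hxi : splitPos f k i = 0 := by
      rw [splitPos, if_neg (by omega), if_pos hi]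
    simp only [hxi, sub_zero]
    refine exists_MSRWeights_sum_eq_zero (indexBlock (6 * f + 1) 0 f)
      (indexBlock (6 * f + 1) (4 * f) (5 * f)) ?_ ?_ ?_ ?_ ?_ ?_ ?_ hγ hγ1 hγn
    · intro j hj
      rw [mem_indexBlock] at hj
      rw [mem_inNbr_splitEdges, ne_eq, Fin.ext_iff]
      omega
    · intro j hj
      rw [mem_indexBlock] at hj
      rw [mem_inNbr_splitEdges, ne_eq, Fin.ext_iff]
      omega
    · rw [card_indexBlock (by omega), Nat.sub_zero]
    · rw [card_indexBlock (by omega)]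
      omega
    · intro j _
      split_ifs <;> norm_num
    · intro j hj hjF
      rw [mem_inNbr_splitEdges] at hj
      rw [mem_indexBlock] at hjF
      exact if_neg (by omega)
    · intro j hj
      rw [mem_indexBlock] at hj
      exact if_neg (by omega)

/-- for every `f ≥ 1` there exists a digraph that is `2f`-robust and has
minimum in-degree `2f+1`, together with a set of at most `f` malicious agents, initial
conditions, time-varying delays bounded by `τ = 1`, and malicious inputs, under which
the normal agents running the asynchronous DP-MSR algorithm fail to reach agreement:
two nonempty disjoint groups of normal agents remain at two distinct constant values
`a < b` for all time. The hypothesis `γ` small (`γ·n ≤ 1` for the constructed `n`)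
makes the weight assignment feasible. -/
theorem async_dpmsr_2f_robust_counterexample (f : ℕ) (hf : 1 ≤ f)
    (T α : ℝ) (hT : 0 < T)
    (hαT1 : 1 + T ^ 2 / 2 ≤ α * T) (hαT2 : α * T ≤ 2 - T ^ 2 / 2) :
    ∃ (n : ℕ) (E : Finset (Fin n × Fin n)),
      IsRSRobust E (2 * f) 1 ∧
      (∀ i : Fin n, 2 * f + 1 ≤ (inNbr E i).card) ∧
      ∀ γ : ℝ, 0 < γ → γ * n ≤ 1 →
        ∃ (M : Finset (Fin n)) (a b : ℝ) (x v u : ℤ → Fin n → ℝ)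
          (d : ℤ → Fin n → Fin n → ℕ),
          M.card ≤ f ∧ a < b ∧
          (∀ k i j, d k i j ≤ 1) ∧
          Dynamics T x v u ∧
          AsyncDPMSR E f γ α M d x v u ∧
          ∃ P1 P2 : Finset (Fin n),
            P1.Nonempty ∧ P2.Nonempty ∧ Disjoint P1 P2 ∧
            Disjoint P1 M ∧ Disjoint P2 M ∧
            ∀ k : ℤ, 0 ≤ k →
              (∀ i ∈ P1, x k i = a) ∧ (∀ i ∈ P2, x k i = b) := by
  refine ⟨6 * f + 1, splitEdges f, isRSRobust_splitEdges f, le_card_inNbr_splitEdges hf, ?_⟩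
  intro γ hγ hγn
  have hγ1 : γ < 1 := by
    have hf' : (1 : ℝ) ≤ f := by exact_mod_cast hf
    push_cast at hγn
    nlinarith
  refine ⟨indexBlock _ (4 * f) (5 * f), 0, 1, splitPos f, splitVel f T, splitInput f T,
    splitDelay, ?_, zero_lt_one, ?_, dynamics_split f hT.ne',
    asyncDPMSR_split hf hγ.le hγ1 hγn, indexBlock _ (5 * f) (6 * f + 1),
    indexBlock _ 0 (4 * f), ?_, ?_, ?_, ?_, ?_, ?_⟩
  · rw [card_indexBlock (by omega)]
    omega
  · intro k i j
    unfold splitDelay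
    split_ifs <;> norm_num
  · rw [← Finset.card_pos, card_indexBlock le_rfl]
    omega
  · rw [← Finset.card_pos, card_indexBlock (by omega)]
    omega
  iterate 3
    · rw [Finset.disjoint_left]
      intro j hj hj'
      rw [mem_indexBlock] at hj hj'
      omega
  · intro k _
    refine ⟨fun i hi => ?_, fun i hi => ?_⟩
    · rw [mem_indexBlock] at hi
      rw [splitPos, if_neg (by omega), if_pos hi.1]
    · rw [mem_indexBlock] at hi
      rw [splitPos, if_pos hi.2]
end
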